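/- arXiv:2402.00511 — 2 statements merged into one kernel-verified Lean document; each statement's English description precedes it below -/
import Mathlib

section
/- Let X be a Banach two-sided ℍ-module, let D(A) be a right ℍ-submodule of X, and let A : D(A) → X be a closed right linear operator such that ρ_S(A) ∩ ℝ ≠ ∅. Then ρ_S(A) is open in the Cassini topology of ℍ (and hence also open in the Euclidean topology of ℍ, which is finer). -/
open MulOpposite Filter Topology Classical

noncomputable section

notation "ℍ" => Quaternion ℝ

/-- A *Banach two-sided `ℍ`-module*: a two-sided `ℍ`-module (left `ℍ`-action, right
`ℍ`-action encoded as a left `ℍᵐᵒᵖ`-action) whose complete norm satisfies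
`‖qx‖ = ‖xq‖ = |q|‖x‖`, and where real scalars act the same on both sides. -/
class QuatBimodule (Y : Type*) [NormedAddCommGroup Y]
    [Module ℍ Y] [Module ℍᵐᵒᵖ Y] : Prop where
  smul_op_comm : ∀ (p q : ℍ) (y : Y), p • (op q • y) = op q • (p • y)
  norm_smul_left : ∀ (q : ℍ) (y : Y), ‖q • y‖ = ‖q‖ * ‖y‖
  norm_smul_right : ∀ (q : ℍ) (y : Y), ‖op q • y‖ = ‖q‖ * ‖y‖
  real_smul_comm : ∀ (r : ℝ) (y : Y), ((r : ℝ) : ℍ) • y = op ((r : ℝ) : ℍ) • y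

variable {X : Type*} [NormedAddCommGroup X] [Module ℍ X] [Module ℍᵐᵒᵖ X]

/-- Membership in `Lin^r(X)`: additive, right `ℍ`-linear, with finite operator
norm (i.e. `‖B x‖` is bounded on the closed unit ball). -/
def MemLinR (B : X → X) : Prop :=
  (∀ x y : X, B (x + y) = B x + B y) ∧
  (∀ (q : ℍ) (x : X), B (op q • x) = op q • B x) ∧
  BddAbove ((fun x : X => ‖B x‖) '' {x : X | ‖x‖ ≤ 1})

/-- The operator norm `‖B‖ = sup {‖B x‖ : ‖x‖ ≤ 1}`. -/
def opNorm (B : X → X) : ℝ :=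
  sSup ((fun x : X => ‖B x‖) '' {x : X | ‖x‖ ≤ 1})

/-- A right linear operator `A : D(A) → X`, where `D(A)` is a right `ℍ`-submodule
of `X`.  It is encoded as a function `X → X` together with its domain; only the
values on the domain are relevant. -/
structure RightLinearOp (X : Type*) [NormedAddCommGroup X]
    [Module ℍ X] [Module ℍᵐᵒᵖ X] where
  dom : Set X
  toFun : X → X
  zero_mem : (0 : X) ∈ dom
  add_mem : ∀ ⦃x⦄, x ∈ dom → ∀ ⦃y⦄, y ∈ dom → x + y ∈ dom
  neg_mem : ∀ ⦃x⦄, x ∈ dom → -x ∈ dom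
  smulR_mem : ∀ (q : ℍ) ⦃x⦄, x ∈ dom → op q • x ∈ dom
  map_add' : ∀ ⦃x⦄, x ∈ dom → ∀ ⦃y⦄, y ∈ dom → toFun (x + y) = toFun x + toFun y
  map_smulR' : ∀ (q : ℍ) ⦃x⦄, x ∈ dom → toFun (op q • x) = op q • toFun x

namespace RightLinearOp

variable (T : RightLinearOp X)

/-- `A` is closed: its graph is closed in `X × X`. -/
def IsClosedOp : Prop := IsClosed {p : X × X | p.1 ∈ T.dom ∧ T.toFun p.1 = p.2}

/-- The domain `D(A²)` of `A²`. -/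
def dom2 : Set X := {x | x ∈ T.dom ∧ T.toFun x ∈ T.dom}

/-- The operator `Δ_q(A) = A² − 2 Re(q) A + |q|² Id`, with domain `D(A²)`. -/
def delta (q : ℍ) (x : X) : X :=
  T.toFun (T.toFun x) - ((2 * q.re : ℝ) : ℍ) • T.toFun x + ((‖q‖ ^ 2 : ℝ) : ℍ) • x

/-- `B` is the inverse of `Δ_q(A) : D(A²) → X`, and `B ∈ Lin^r(X)`. -/
def IsQInv (q : ℍ) (B : X → X) : Prop :=
  MemLinR B ∧ (∀ x : X, B x ∈ T.dom2) ∧ (∀ x : X, T.delta q (B x) = x) ∧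
    ∀ x ∈ T.dom2, B (T.delta q x) = x

/-- The S-resolvent set `ρ_S(A)`. -/
def rhoS : Set ℍ := {q | ∃ B : X → X, T.IsQInv q B}

/-- `Q_q(A) = Δ_q(A)⁻¹ ∈ Lin^r(X)`, for `q ∈ ρ_S(A)` (junk value otherwise). -/
def qres (q : ℍ) : X → X :=
  if h : q ∈ T.rhoS then h.choose else fun _ => 0

/-- The (left) S-resolvent operator `S_q⁻¹(A) = Q_q(A) q̄ − A Q_q(A)`, where the
right scalar multiple of an operator is `(B q̄)(x) = B(q̄ x)`. -/
def sres (q : ℍ) : X → X :=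
  fun x => T.qres q (star q • x) - T.toFun (T.qres q x)

/-- The coefficients `B_n`: `B_{2k} = Q_{q0}(A)^k`, `B_{2k+1} = Q_{q0}(A)^k S_{q0}⁻¹(A)`. -/
def Bop (q0 : ℍ) (n : ℕ) : X → X :=
  if n % 2 = 0 then (T.qres q0)^[n / 2] else (T.qres q0)^[n / 2] ∘ T.sres q0

end RightLinearOp

/-- The quaternionic polynomial `Δ_q(p) = p² − 2 Re(q) p + |q|²`. -/
def deltaPoly (q p : ℍ) : ℍ :=
  p ^ 2 - ((2 * q.re : ℝ) : ℍ) * p + ((‖q‖ ^ 2 : ℝ) : ℍ)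

/-- The "powers" `p_{q0,n}`: `p_{q0,2k}(q) = Δ_{q0}(q)^k`,
`p_{q0,2k+1}(q) = (q − q0) Δ_{q0}(q)^k`. -/
def spow (q0 : ℍ) (n : ℕ) (q : ℍ) : ℍ :=
  if n % 2 = 0 then deltaPoly q0 q ^ (n / 2) else (q - q0) * deltaPoly q0 q ^ (n / 2)

/-- The Cassini pseudo-metric `u(p,q) = √|Δ_q(p)|`. -/
def cassini (p q : ℍ) : ℝ := Real.sqrt ‖deltaPoly q p‖

/-- The Cassini ball `U(q0,R)`. -/
def cassiniBall (q0 : ℍ) (R : ℝ) : Set ℍ := {p : ℍ | cassini p q0 < R}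

/-- The Cassini topology on `ℍ`: the topology induced by the Cassini pseudo-metric,
i.e. the topology generated by the Cassini balls. -/
def cassiniTopology : TopologicalSpace ℍ :=
  TopologicalSpace.generateFrom {U : Set ℍ | ∃ q0 R, 0 < R ∧ U = cassiniBall q0 R}

/-- The spherical derivative of a function `g : ℍ → ℍ`. -/
def sderivQ (g : ℍ → ℍ) (q : ℍ) : ℍ :=
  if q.im = 0 then deriv (fun t : ℝ => g ((t : ℝ) : ℍ)) q.re
  else (g q - g (star q)) * (q - star q)⁻¹

end

theorem Quaternion.norm_sq_eq (q : ℍ) :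
    ‖q‖ ^ 2 = q.re ^ 2 + q.imI ^ 2 + q.imJ ^ 2 + q.imK ^ 2 := by
  rw [pow_two, ← Quaternion.normSq_eq_norm_mul_self, Quaternion.normSq_def']

theorem Quaternion.norm_im_sq_eq (q : ℍ) : ‖q.im‖ ^ 2 = q.imI ^ 2 + q.imJ ^ 2 + q.imK ^ 2 := by
  simp [Quaternion.norm_sq_eq]

theorem Quaternion.norm_sq_eq_re_sq_add (q : ℍ) : ‖q‖ ^ 2 = q.re ^ 2 + ‖q.im‖ ^ 2 := by
  rw [Quaternion.norm_sq_eq, Quaternion.norm_im_sq_eq]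
  ring

/-- The real normed space underlying a Banach two-sided `ℍ`-module. -/
@[reducible]
noncomputable def QuatBimodule.normedSpaceReal (X : Type*) [NormedAddCommGroup X]
    [Module ℍ X] [Module ℍᵐᵒᵖ X] [QuatBimodule X] : NormedSpace ℝ X where
  __ := Module.compHom X (algebraMap ℝ ℍ)
  norm_smul_le r x := by
    change ‖(r : ℍ) • x‖ ≤ _
    rw [QuatBimodule.norm_smul_left, Quaternion.norm_coe]

namespace RightLinearOp

theorem coe_smul_eq {X : Type*} [NormedAddCommGroup X] [Module ℍ X] [NormedSpace ℝ X]
    [IsScalarTower ℝ ℍ X] (r : ℝ) (x : X) :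
    (r : ℍ) • x = r • x :=
  algebraMap_smul ℍ r x

section Algebra

variable {X : Type*} [NormedAddCommGroup X] [Module ℍ X] [Module ℍᵐᵒᵖ X] (T : RightLinearOp X)

theorem sub_mem {x y : X} (hx : x ∈ T.dom) (hy : y ∈ T.dom) : x - y ∈ T.dom :=
  sub_eq_add_neg x y ▸ T.add_mem hx (T.neg_mem hy)

theorem map_sub {x y : X} (hx : x ∈ T.dom) (hy : y ∈ T.dom) :
    T.toFun (x - y) = T.toFun x - T.toFun y := by
  have h := T.map_add' (T.sub_mem hx hy) hy
  rw [sub_add_cancel] at h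
  exact eq_sub_of_add_eq h.symm

variable {T}

theorem IsQInv.map_zero {q : ℍ} {B : X → X} (hB : T.IsQInv q B) : B 0 = 0 := by
  simpa using hB.1.1 0 0

theorem IsQInv.eq_zero_of_delta {q : ℍ} {B : X → X} (hB : T.IsQInv q B) {x : X}
    (hx : x ∈ T.dom2) (h : T.delta q x = 0) : x = 0 := by
  rw [← hB.2.2.2 x hx, h, hB.map_zero]

end Algebra

/-- The bounded operator `Δ_q(A) R²`, where `R = (A - r)⁻¹`, `s = Re(q)` and `t = |Im(q)|`. -/
noncomputable def deltaResolvent {X : Type*} [NormedAddCommGroup X] [NormedSpace ℝ X]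
    (r : ℝ) (R : X →L[ℝ] X) (s t : ℝ) : X →L[ℝ] X :=
  1 + (2 * (r - s)) • R + ((r - s) ^ 2 + t ^ 2) • R ^ 2

theorem deltaResolvent_apply {X : Type*} [NormedAddCommGroup X] [NormedSpace ℝ X]
    (r : ℝ) (R : X →L[ℝ] X) (s t : ℝ) (y : X) :
    deltaResolvent r R s t y =
      y + (2 * (r - s)) • R y + ((r - s) ^ 2 + t ^ 2) • R (R y) := by
  simp [deltaResolvent, pow_two R]

section Resolvent

variable {X : Type*} [NormedAddCommGroup X] [Module ℍ X] [Module ℍᵐᵒᵖ X]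
  [NormedSpace ℝ X]

theorem op_coe_smul_eq [QuatBimodule X] [IsScalarTower ℝ ℍ X] (r : ℝ) (x : X) :
    op (r : ℍ) • x = r • x := by
  rw [← QuatBimodule.real_smul_comm, coe_smul_eq]

theorem op_smul_real_smul [QuatBimodule X] [IsScalarTower ℝ ℍ X]
    (q : ℍ) (r : ℝ) (x : X) : op q • r • x = r • op q • x := by
  rw [← coe_smul_eq, ← coe_smul_eq, QuatBimodule.smul_op_comm]

theorem delta_eq [IsScalarTower ℝ ℍ X] (T : RightLinearOp X) (q : ℍ) (x : X) :
    T.delta q x = T.toFun (T.toFun x) - (2 * q.re) • T.toFun x + (‖q‖ ^ 2) • x := by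
  rw [delta, coe_smul_eq, coe_smul_eq]

variable [QuatBimodule X] [IsScalarTower ℝ ℍ X] (T : RightLinearOp X)

theorem smul_mem (r : ℝ) {x : X} (hx : x ∈ T.dom) : r • x ∈ T.dom :=
  op_coe_smul_eq r x ▸ T.smulR_mem r hx

theorem map_smul (r : ℝ) {x : X} (hx : x ∈ T.dom) : T.toFun (r • x) = r • T.toFun x := by
  rw [← op_coe_smul_eq, T.map_smulR' _ hx, op_coe_smul_eq]

/-- `R` is the bounded, right linear, two-sided inverse of `A - r`. -/
structure IsRealResolvent (r : ℝ) (R : X →L[ℝ] X) : Prop where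
  map_op_smul : ∀ (q : ℍ) (x : X), R (op q • x) = op q • R x
  mem_dom : ∀ x, R x ∈ T.dom
  apply_eq : ∀ x, T.toFun (R x) = x + r • R x
  left_inv : ∀ x ∈ T.dom, R (T.toFun x - r • x) = x

variable {T}

theorem exists_isRealResolvent [CompleteSpace X] (hT : T.IsClosedOp) {r : ℝ}
    (hr : (r : ℍ) ∈ T.rhoS) : ∃ R : X →L[ℝ] X, T.IsRealResolvent r R := by
  obtain ⟨B, hB⟩ := hr
  have hdelta (x : X) : T.delta r x
      = T.toFun (T.toFun x) - (2 * r) • T.toFun x + (r ^ 2) • x := by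
    simp [delta_eq, Quaternion.norm_coe]
  have hinj {w : X} (hw : w ∈ T.dom) (h : T.toFun w = r • w) : w = 0 := by
    refine hB.eq_zero_of_delta ⟨hw, h ▸ T.smul_mem r hw⟩ ?_
    rw [hdelta, h, T.map_smul r hw, h]
    module
  have hB1 (x : X) : B x ∈ T.dom := (hB.2.1 x).1
  have hB2 (x : X) : T.toFun (B x) ∈ T.dom := (hB.2.1 x).2
  have hBs (s : ℝ) (x : X) : B (s • x) = s • B x := by
    rw [← op_coe_smul_eq, hB.1.2.1, op_coe_smul_eq]
  let R : X →ₗ[ℝ] X :=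
    { toFun := fun x => T.toFun (B x) - r • B x
      map_add' := fun x y => by
        rw [hB.1.1, T.map_add' (hB1 x) (hB1 y)]
        module
      map_smul' := fun s x => by
        rw [hBs, T.map_smul s (hB1 x), RingHom.id_apply]
        module }
  have hmem (x : X) : R x ∈ T.dom := T.sub_mem (hB2 x) (T.smul_mem r (hB1 x))
  have happ (x : X) : T.toFun (R x) = x + r • R x := by
    have h : T.toFun (R x) = T.toFun (T.toFun (B x)) - r • T.toFun (B x) := by
      change T.toFun (T.toFun (B x) - r • B x) = _
      rw [T.map_sub (hB2 x) (T.smul_mem r (hB1 x)), T.map_smul r (hB1 x)]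
    have h' := hB.2.2.1 x
    rw [hdelta] at h'
    rw [h]
    nth_rw 3 [← h']
    change _ = _ + r • (T.toFun (B x) - r • B x)
    module
  have hleft (x : X) (hx : x ∈ T.dom) : R (T.toFun x - r • x) = x := by
    refine sub_eq_zero.mp (hinj (T.sub_mem (hmem _) hx) ?_)
    rw [T.map_sub (hmem _) hx, happ]
    module
  have hgraph : IsClosed (R.graph : Set (X × X)) := by
    have hcont : Continuous fun p : X × X => (p.2, p.1 + r • p.2) := by fun_prop
    convert IsClosed.preimage hcont hT using 1
    ext ⟨x, y⟩
    simp only [SetLike.mem_coe, LinearMap.mem_graph_iff, Set.mem_preimage, Set.mem_ofPred_eq]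
    refine ⟨fun h => ⟨h ▸ hmem x, by rw [h, happ]⟩, fun ⟨hy, h⟩ => ?_⟩
    have := hleft y hy
    rwa [h, add_sub_cancel_right, eq_comm] at this
  refine ⟨⟨R, R.continuous_of_isClosed_graph hgraph⟩, fun q x => ?_, hmem, happ, hleft⟩
  change T.toFun (B (op q • x)) - r • B (op q • x) = op q • (T.toFun (B x) - r • B x)
  rw [hB.1.2.1, T.map_smulR' q (hB1 x), smul_sub, op_smul_real_smul]

variable {r : ℝ} {R : X →L[ℝ] X}

theorem IsRealResolvent.sq_mem_dom2 (hR : T.IsRealResolvent r R) (y : X) :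
    R (R y) ∈ T.dom2 :=
  ⟨hR.mem_dom _, hR.apply_eq (R y) ▸ T.add_mem (hR.mem_dom _) (T.smul_mem r (hR.mem_dom _))⟩

theorem IsRealResolvent.delta_sq (hR : T.IsRealResolvent r R) (q : ℍ) (y : X) :
    T.delta q (R (R y)) = deltaResolvent r R q.re ‖q.im‖ y := by
  rw [delta_eq, hR.apply_eq, T.map_add' (hR.mem_dom _) (T.smul_mem r (hR.mem_dom _)),
    T.map_smul r (hR.mem_dom _), hR.apply_eq, hR.apply_eq, Quaternion.norm_sq_eq_re_sq_add,
    deltaResolvent_apply]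
  module

theorem IsRealResolvent.exists_sq_eq (hR : T.IsRealResolvent r R) {x : X} (hx : x ∈ T.dom2) :
    ∃ y, R (R y) = x := by
  have hmem : T.toFun x - r • x ∈ T.dom := T.sub_mem hx.2 (T.smul_mem r hx.1)
  exact ⟨_, by rw [hR.left_inv _ hmem, hR.left_inv _ hx.1]⟩

theorem IsRealResolvent.eq_zero (hR : T.IsRealResolvent r R) {x : X} (hx : R x = 0) : x = 0 := by
  have h := hR.apply_eq x
  have h0 : T.toFun 0 = 0 := by simpa using T.map_smul 0 T.zero_mem
  simpa [hx, h0, eq_comm] using h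

theorem IsRealResolvent.mem_rhoS_iff [CompleteSpace X] (hR : T.IsRealResolvent r R)
    (q : ℍ) : q ∈ T.rhoS ↔ IsUnit (deltaResolvent r R q.re ‖q.im‖) := by
  set P := deltaResolvent r R q.re ‖q.im‖ with hP
  constructor
  · rintro ⟨B, hB⟩
    rw [ContinuousLinearMap.isUnit_iff_bijective]
    refine ⟨(injective_iff_map_eq_zero P).mpr fun y hy => ?_, fun z => ?_⟩
    · rw [hP, ← hR.delta_sq] at hy
      exact hR.eq_zero (hR.eq_zero (hB.eq_zero_of_delta (hR.sq_mem_dom2 y) hy))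
    · obtain ⟨y, hy⟩ := hR.exists_sq_eq (hB.2.1 z)
      exact ⟨y, by rw [hP, ← hR.delta_sq, hy, hB.2.2.1]⟩
  · rintro ⟨u, hu⟩
    have hPU (x : X) : P (u⁻¹.val x) = x := by
      simpa [hu] using DFunLike.congr_fun u.mul_inv x
    have hUP (x : X) : u⁻¹.val (P x) = x := by
      simpa [hu] using DFunLike.congr_fun u.inv_mul x
    have hPop (p : ℍ) (x : X) : P (op p • x) = op p • P x := by
      simp only [hP, deltaResolvent_apply, hR.map_op_smul, smul_add, op_smul_real_smul]
    have hUop (p : ℍ) (x : X) : u⁻¹.val (op p • x) = op p • u⁻¹.val x := by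
      rw [← hUP (op p • u⁻¹.val x), hPop, hPU]
    let Q : X →L[ℝ] X := R * R * u⁻¹.val
    have hQ (x : X) : Q x = R (R (u⁻¹.val x)) := rfl
    refine ⟨Q, ⟨map_add Q, fun p x => ?_, ‖Q‖, ?_⟩, fun x => hR.sq_mem_dom2 _, fun x => ?_,
      fun x hx => ?_⟩
    · rw [hQ, hUop, hR.map_op_smul, hR.map_op_smul, hQ]
    · rintro _ ⟨x, hx, rfl⟩
      exact Q.unit_le_opNorm x hx
    · rw [hQ, hR.delta_sq, ← hP, hPU]
    · obtain ⟨y, rfl⟩ := hR.exists_sq_eq hx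
      rw [hQ, hR.delta_sq, ← hP, hUP]

end Resolvent

end RightLinearOp

theorem normSq_deltaPoly (q p : ℍ) :
    ‖deltaPoly q p‖ ^ 2 = ((p.re - q.re) ^ 2 + (‖p.im‖ - ‖q.im‖) ^ 2) *
      ((p.re - q.re) ^ 2 + (‖p.im‖ + ‖q.im‖) ^ 2) := by
  have hrhs : ((p.re - q.re) ^ 2 + (‖p.im‖ - ‖q.im‖) ^ 2) *
      ((p.re - q.re) ^ 2 + (‖p.im‖ + ‖q.im‖) ^ 2) =
      ((p.re - q.re) ^ 2 + ‖p.im‖ ^ 2 + ‖q.im‖ ^ 2) ^ 2 - 4 * ‖p.im‖ ^ 2 * ‖q.im‖ ^ 2 := by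
    ring
  rw [hrhs, deltaPoly, Quaternion.norm_sq_eq q, Quaternion.norm_sq_eq, Quaternion.norm_im_sq_eq,
    Quaternion.norm_im_sq_eq]
  simp only [pow_two p, Quaternion.re_add, Quaternion.re_sub, Quaternion.re_mul, Quaternion.re_coe,
    Quaternion.imI_add, Quaternion.imI_sub, Quaternion.imI_mul, Quaternion.imI_coe,
    Quaternion.imJ_add, Quaternion.imJ_sub, Quaternion.imJ_mul, Quaternion.imJ_coe,
    Quaternion.imK_add, Quaternion.imK_sub, Quaternion.imK_mul, Quaternion.imK_coe]
  ring

theorem cassini_self (q : ℍ) : cassini q q = 0 := by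
  have h := normSq_deltaPoly q q
  simp only [sub_self] at h
  simp [cassini, pow_eq_zero_iff two_ne_zero |>.mp (h.trans (by ring))]

theorem dist_re_norm_im_le_cassini (p q : ℍ) :
    dist (p.re, ‖p.im‖) (q.re, ‖q.im‖) ≤ cassini p q := by
  have h : (p.re - q.re) ^ 2 + (‖p.im‖ - ‖q.im‖) ^ 2 ≤ ‖deltaPoly q p‖ := by
    refine le_of_sq_le_sq ?_ (norm_nonneg _)
    rw [normSq_deltaPoly, pow_two]
    refine mul_le_mul_of_nonneg_left ?_ (by positivity)
    nlinarith [mul_nonneg (norm_nonneg p.im) (norm_nonneg q.im)]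
  rw [Prod.dist_eq, Real.dist_eq, Real.dist_eq, cassini]
  refine max_le (Real.le_sqrt_of_sq_le ?_) (Real.le_sqrt_of_sq_le ?_) <;> rw [sq_abs] <;>
    nlinarith [sq_nonneg (p.re - q.re), sq_nonneg (‖p.im‖ - ‖q.im‖)]

theorem isOpen_cassini_preimage {V : Set (ℝ × ℝ)} (hV : IsOpen V) :
    @IsOpen ℍ cassiniTopology ((fun q => (q.re, ‖q.im‖)) ⁻¹' V) := by
  refine (@isOpen_iff_forall_mem_open _ cassiniTopology _).mpr fun q hq => ?_
  obtain ⟨ε, hε, hball⟩ := Metric.isOpen_iff.mp hV _ hq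
  refine ⟨cassiniBall q ε,
    fun p hp => hball ((dist_re_norm_im_le_cassini p q).trans_lt hp),
    TopologicalSpace.isOpen_generateFrom_of_mem ⟨q, ε, hε, rfl⟩, ?_⟩
  change cassini q q < ε
  rwa [cassini_self]

/-- Theorem `T:main`(ii): if `ρ_S(A) ∩ ℝ ≠ ∅`, then `ρ_S(A)` is
open in the Cassini topology of `ℍ`, and hence also open in the Euclidean topology. -/
theorem stmt2 {X : Type*} [NormedAddCommGroup X] [CompleteSpace X]
    [Module ℍ X] [Module ℍᵐᵒᵖ X] [QuatBimodule X]
    (T : RightLinearOp X) (hT : T.IsClosedOp)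
    (hreal : ∃ r : ℝ, ((r : ℝ) : ℍ) ∈ T.rhoS) :
    @IsOpen ℍ cassiniTopology T.rhoS ∧ IsOpen T.rhoS := by
  let _ : NormedSpace ℝ X := QuatBimodule.normedSpaceReal X
  have : IsScalarTower ℝ ℍ X := ⟨fun r q x => by
    rw [Algebra.smul_def, mul_smul]
    rfl⟩
  obtain ⟨r, hr⟩ := hreal
  obtain ⟨R, hR⟩ := RightLinearOp.exists_isRealResolvent hT hr
  let V : Set (ℝ × ℝ) := {p | IsUnit (RightLinearOp.deltaResolvent r R p.1 p.2)}
  have hV : IsOpen V := by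
    refine Units.isOpen.preimage (f := fun p : ℝ × ℝ => RightLinearOp.deltaResolvent r R p.1 p.2) ?_
    unfold RightLinearOp.deltaResolvent
    fun_prop
  have hrho : T.rhoS = (fun q => (q.re, ‖q.im‖)) ⁻¹' V := Set.ext hR.mem_rhoS_iff
  rw [hrho]
  refine ⟨isOpen_cassini_preimage hV, hV.preimage ?_⟩
  exact Quaternion.continuous_re.prodMk Quaternion.continuous_im.norm
end

section
/- Let X be a Banach two-sided ℍ-module, let D(A) be a right ℍ-submodule of X, and let A : D(A) → X be a closed right linear operator such that ρ_S(A) ∩ ℝ ≠ ∅. If ρ_S(A) is endowed with the relative topology induced by the Cassini topology of ℍ, then the mapping ρ_S(A) → Lin^r(X), q ↦ Q_q(A), is continuous. -/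
open MulOpposite Filter Topology Classical

section Cassini

lemma deltaPoly_re (q p : ℍ) :
    (deltaPoly q p).re = 2 * (p.re - q.re) * p.re + (‖q‖ ^ 2 - ‖p‖ ^ 2) := by
  have hp := Quaternion.normSq_eq_norm_mul_self p
  rw [Quaternion.normSq_def'] at hp
  simp only [deltaPoly, pow_two, Quaternion.re_add, Quaternion.re_sub, Quaternion.re_mul,
    Quaternion.re_coe, Quaternion.imI_coe, Quaternion.imJ_coe, Quaternion.imK_coe]
  linear_combination -hp

lemma sq_re_sub_re_le_norm_deltaPoly (q p : ℍ) : (p.re - q.re) ^ 2 ≤ ‖deltaPoly q p‖ := by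
  have hq := Quaternion.normSq_eq_norm_mul_self q
  rw [Quaternion.normSq_def'] at hq
  refine le_of_sq_le_sq ?_ (norm_nonneg _)
  have hd := Quaternion.normSq_eq_norm_mul_self (deltaPoly q p)
  rw [Quaternion.normSq_def'] at hd
  rw [pow_two ‖deltaPoly q p‖, ← hd]
  simp only [deltaPoly, pow_two ‖q‖, ← hq, pow_two p, Quaternion.re_add, Quaternion.re_sub,
    Quaternion.re_mul, Quaternion.imI_add, Quaternion.imI_sub, Quaternion.imI_mul,
    Quaternion.imJ_add, Quaternion.imJ_sub, Quaternion.imJ_mul,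
    Quaternion.imK_add, Quaternion.imK_sub, Quaternion.imK_mul,
    Quaternion.re_coe, Quaternion.imI_coe, Quaternion.imJ_coe, Quaternion.imK_coe]
  have key : ∀ d b c : ℝ, 0 ≤ b → 0 ≤ c →
      (d ^ 2) ^ 2 ≤ (d ^ 2 + c - b) ^ 2 + 4 * d ^ 2 * b := by
    intro d b c hb hc
    nlinarith [sq_nonneg (c - b), mul_nonneg (sq_nonneg d) hb, mul_nonneg (sq_nonneg d) hc]
  have := key (p.re - q.re) (p.imI ^ 2 + p.imJ ^ 2 + p.imK ^ 2)
    (q.imI ^ 2 + q.imJ ^ 2 + q.imK ^ 2) (by positivity) (by positivity)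
  refine this.trans (le_of_eq ?_)
  ring

lemma cassini_sq (p q : ℍ) : cassini p q ^ 2 = ‖deltaPoly q p‖ :=
  Real.sq_sqrt (norm_nonneg _)

lemma cassini_nonneg (p q : ℍ) : 0 ≤ cassini p q := Real.sqrt_nonneg _

lemma abs_re_sub_re_le_cassini (p q : ℍ) : |p.re - q.re| ≤ cassini p q := by
  refine abs_le_of_sq_le_sq ?_ (cassini_nonneg p q)
  rw [cassini_sq]
  exact sq_re_sub_re_le_norm_deltaPoly q p

lemma abs_norm_sq_sub_norm_sq_le_cassini (p q : ℍ) :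
    |‖q‖ ^ 2 - ‖p‖ ^ 2| ≤ cassini p q ^ 2 + 2 * cassini p q * (|q.re| + cassini p q) := by
  have hd := abs_re_sub_re_le_cassini p q
  have hre : |(deltaPoly q p).re| ≤ cassini p q ^ 2 := by
    rw [cassini_sq]
    refine abs_le_of_sq_le_sq ?_ (norm_nonneg _)
    rw [pow_two ‖deltaPoly q p‖, ← Quaternion.normSq_eq_norm_mul_self, Quaternion.normSq_def']
    linarith [sq_nonneg (deltaPoly q p).imI, sq_nonneg (deltaPoly q p).imJ,
      sq_nonneg (deltaPoly q p).imK]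
  have hp : |p.re| ≤ |q.re| + cassini p q := by
    have := abs_add_le q.re (p.re - q.re)
    rw [add_sub_cancel] at this
    linarith
  have hm : |2 * (p.re - q.re) * p.re| ≤ 2 * cassini p q * (|q.re| + cassini p q) := by
    rw [abs_mul, abs_mul, abs_two]
    have := cassini_nonneg p q
    gcongr
  calc |‖q‖ ^ 2 - ‖p‖ ^ 2| = |(deltaPoly q p).re - 2 * (p.re - q.re) * p.re| := by
        rw [deltaPoly_re]; congr 1; ring
    _ ≤ |(deltaPoly q p).re| + |2 * (p.re - q.re) * p.re| := abs_sub _ _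
    _ ≤ _ := add_le_add hre hm

end Cassini

section Bounded

variable {X : Type*} [NormedAddCommGroup X]

lemma opNorm_le_of_bound {B : X → X} {C : ℝ} (hC : 0 ≤ C) (h : ∀ x, ‖B x‖ ≤ C * ‖x‖) :
    opNorm B ≤ C := by
  refine csSup_le ⟨_, 0, by simp, rfl⟩ ?_
  rintro _ ⟨x, hx, rfl⟩
  exact (h x).trans (mul_le_of_le_one_right hC hx)

lemma opNorm_nonneg (B : X → X) : 0 ≤ opNorm B := by
  refine Real.sSup_nonneg ?_
  rintro _ ⟨x, -, rfl⟩
  exact norm_nonneg _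

lemma MemLinR.map_sub [Module ℍᵐᵒᵖ X] {B : X → X} (hB : MemLinR B) (x y : X) : B (x - y) = B x - B y :=
  (AddMonoidHom.mk' B hB.1).map_sub x y

variable [Module ℍ X] [Module ℍᵐᵒᵖ X]

lemma MemLinR.norm_le_opNorm_mul [QuatBimodule X] {B : X → X} (hB : MemLinR B) (x : X) :
    ‖B x‖ ≤ opNorm B * ‖x‖ := by
  rcases eq_or_ne x 0 with rfl | hx
  · have : B 0 = 0 := (AddMonoidHom.mk' B hB.1).map_zero
    simp [this]
  have hx' : 0 < ‖x‖ := norm_pos_iff.2 hx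
  have hc : ‖((‖x‖⁻¹ : ℝ) : ℍ)‖ = ‖x‖⁻¹ := by simp
  have hle : ‖B (op ((‖x‖⁻¹ : ℝ) : ℍ) • x)‖ ≤ opNorm B := by
    refine le_csSup hB.2.2 ⟨_, ?_, rfl⟩
    rw [Set.mem_ofPred_eq, QuatBimodule.norm_smul_right, hc, inv_mul_cancel₀ hx'.ne']
  rwa [hB.2.1, QuatBimodule.norm_smul_right, hc, inv_mul_le_iff₀ hx', mul_comm] at hle

lemma MemLinR.continuous [QuatBimodule X] {B : X → X} (hB : MemLinR B) : Continuous B :=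
  AddMonoidHomClass.continuous_of_bound (AddMonoidHom.mk' B hB.1) (opNorm B)
    hB.norm_le_opNorm_mul

/-- The closed graph theorem for right linear operators defined on the whole module. -/
lemma exists_bound_of_closed_graph [CompleteSpace X] [QuatBimodule X] {B : X → X}
    (hadd : ∀ x y, B (x + y) = B x + B y) (hsmul : ∀ (q : ℍ) (x : X), B (op q • x) = op q • B x)
    (hclosed : ∀ (u : ℕ → X) (x y : X), Tendsto u atTop (𝓝 x) →
      Tendsto (B ∘ u) atTop (𝓝 y) → y = B x) :
    ∃ M : ℝ, 0 ≤ M ∧ ∀ x, ‖B x‖ ≤ M * ‖x‖ := by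
  let : Module ℝ X := Module.compHom X (algebraMap ℝ ℍ)
  have hdef : ∀ (r : ℝ) (x : X), r • x = (r : ℍ) • x := fun _ _ => rfl
  let : NormedSpace ℝ X :=
    { norm_smul_le := fun r x => by
        rw [hdef, QuatBimodule.norm_smul_left, Quaternion.norm_coe] }
  let L : X →ₗ[ℝ] X :=
    { toFun := B
      map_add' := hadd
      map_smul' := fun r x => by
        rw [RingHom.id_apply, hdef, hdef, QuatBimodule.real_smul_comm, hsmul,
          QuatBimodule.real_smul_comm] }
  let F : X →L[ℝ] X := ⟨L, L.continuous_of_seq_closed_graph hclosed⟩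
  exact ⟨‖F‖, norm_nonneg _, F.le_opNorm⟩

end Bounded

namespace RightLinearOp

variable {X : Type*} [NormedAddCommGroup X] [Module ℍ X] [Module ℍᵐᵒᵖ X] (T : RightLinearOp X)

lemma isQInv_qres {q : ℍ} (hq : q ∈ T.rhoS) : T.IsQInv q (T.qres q) := by
  rw [qres, dif_pos hq]
  exact hq.choose_spec

lemma exists_bound_toFun_comp [CompleteSpace X] [QuatBimodule X] (hT : T.IsClosedOp) {B : X → X}
    (hB : MemLinR B) (hdom : ∀ x, B x ∈ T.dom) :
    ∃ M : ℝ, 0 ≤ M ∧ ∀ x, ‖T.toFun (B x)‖ ≤ M * ‖x‖ := by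
  refine exists_bound_of_closed_graph (B := fun x => T.toFun (B x)) ?_ ?_ ?_
  · intro x y
    rw [hB.1, T.map_add' (hdom x) (hdom y)]
  · intro q x
    rw [hB.2.1, T.map_smulR' q (hdom x)]
  · intro u x y hu hy
    have hlim : Tendsto (fun n => (B (u n), T.toFun (B (u n)))) atTop (𝓝 (B x, y)) :=
      ((hB.continuous.tendsto x).comp hu).prodMk_nhds hy
    exact (hT.mem_of_tendsto hlim (Eventually.of_forall fun n => ⟨hdom (u n), rfl⟩)).2.symm

lemma delta_sub_delta (p q : ℍ) (y : X) :
    T.delta q y - T.delta p y =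
      ((2 * (p.re - q.re) : ℝ) : ℍ) • T.toFun y + ((‖q‖ ^ 2 - ‖p‖ ^ 2 : ℝ) : ℍ) • y := by
  have h₁ : ((2 * (p.re - q.re) : ℝ) : ℍ) = ((2 * p.re : ℝ) : ℍ) - ((2 * q.re : ℝ) : ℍ) := by
    rw [mul_sub, Quaternion.coe_sub]
  rw [h₁, Quaternion.coe_sub, sub_smul, sub_smul, delta, delta]
  abel

/-- The resolvent identity `Q_p - Q_q = Q_p (Δ_q - Δ_p) Q_q`. -/
lemma qres_sub_qres {p q : ℍ} (hp : p ∈ T.rhoS) (hq : q ∈ T.rhoS) (x : X) :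
    T.qres p x - T.qres q x =
      T.qres p (T.delta q (T.qres q x) - T.delta p (T.qres q x)) := by
  obtain ⟨hBp, -, -, hinv⟩ := T.isQInv_qres hp
  obtain ⟨-, hdom, hid, -⟩ := T.isQInv_qres hq
  rw [hBp.map_sub, hid, hinv _ (hdom x)]

end RightLinearOp

/-- Corollary `cor3`, second part: the map `q ↦ Q_q(A)` is
continuous from `ρ_S(A)` (with the relative topology induced by the Cassini
pseudo-metric) to `Lin^r(X)` (with the operator norm); stated in ε-δ form. -/
theorem stmt5 {X : Type*} [NormedAddCommGroup X] [CompleteSpace X]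
    [Module ℍ X] [Module ℍᵐᵒᵖ X] [QuatBimodule X]
    (T : RightLinearOp X) (hT : T.IsClosedOp)
    (hreal : ∃ r : ℝ, ((r : ℝ) : ℍ) ∈ T.rhoS) :
    ∀ q ∈ T.rhoS, ∀ ε : ℝ, 0 < ε → ∃ δ : ℝ, 0 < δ ∧
      ∀ p ∈ T.rhoS, cassini p q < δ →
        opNorm (fun x : X => T.qres p x - T.qres q x) < ε := by
  intro q hq ε hε
  obtain ⟨hBq, hdom, -, -⟩ := T.isQInv_qres hq
  obtain ⟨M, hM, hAM⟩ := T.exists_bound_toFun_comp hT hBq fun x => (hdom x).1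
  set C := opNorm (T.qres q) with hCdef
  have hC : 0 ≤ C := opNorm_nonneg _
  set L := 2 * M + (3 + 2 * |q.re|) * C with hLdef
  have hL : 0 ≤ L := by positivity
  refine ⟨min 1 (min (1 / (2 * (L + 1))) (ε / (2 * (C + 1) * (L + 1)))), by positivity, ?_⟩
  intro p hp hu
  have hre := abs_re_sub_re_le_cassini p q
  have hsq := abs_norm_sq_sub_norm_sq_le_cassini p q
  have hu0 := cassini_nonneg p q
  set u := cassini p q
  rw [lt_min_iff, lt_min_iff, lt_div_iff₀ (by positivity), lt_div_iff₀ (by positivity)] at hu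
  obtain ⟨hu1, hu2, hu3⟩ := hu
  have hBp := (T.isQInv_qres hp).1
  set K := opNorm (T.qres p)
  have hK : 0 ≤ K := opNorm_nonneg _
  have hsq' : |‖q‖ ^ 2 - ‖p‖ ^ 2| ≤ u * (3 + 2 * |q.re|) := by nlinarith
  have hE : ∀ x, ‖T.delta q (T.qres q x) - T.delta p (T.qres q x)‖ ≤ u * L * ‖x‖ := by
    intro x
    rw [T.delta_sub_delta]
    refine (norm_add_le _ _).trans ?_
    rw [QuatBimodule.norm_smul_left, QuatBimodule.norm_smul_left, Quaternion.norm_coe,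
      Quaternion.norm_coe, Real.norm_eq_abs, Real.norm_eq_abs, abs_mul, abs_two]
    calc 2 * |p.re - q.re| * ‖T.toFun (T.qres q x)‖ + |‖q‖ ^ 2 - ‖p‖ ^ 2| * ‖T.qres q x‖
        ≤ 2 * u * (M * ‖x‖) + u * (3 + 2 * |q.re|) * (C * ‖x‖) := by
          gcongr
          · exact hAM x
          · exact hBq.norm_le_opNorm_mul x
      _ = u * L * ‖x‖ := by rw [hLdef]; ring
  have hdiff : ∀ x, ‖T.qres p x - T.qres q x‖ ≤ K * (u * L) * ‖x‖ := by
    intro x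
    rw [T.qres_sub_qres hp hq, mul_assoc]
    exact (hBp.norm_le_opNorm_mul _).trans (by gcongr; exact hE x)
  have hKle : K ≤ C + K * (u * L) := by
    refine opNorm_le_of_bound (by positivity) fun x => ?_
    calc ‖T.qres p x‖ = ‖T.qres q x + (T.qres p x - T.qres q x)‖ := by rw [add_sub_cancel]
      _ ≤ C * ‖x‖ + K * (u * L) * ‖x‖ :=
          (norm_add_le _ _).trans (add_le_add (hBq.norm_le_opNorm_mul x) (hdiff x))
      _ = _ := by ring
  have hK2 : K ≤ 2 * C := by
    have huL : u * L ≤ 1 / 2 := by nlinarith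
    nlinarith
  refine (opNorm_le_of_bound (by positivity) hdiff).trans_lt ?_
  calc K * (u * L) ≤ 2 * C * (u * L) := by gcongr
    _ ≤ u * (2 * (C + 1) * (L + 1)) := by
        nlinarith [mul_nonneg hu0 hC, mul_nonneg hu0 hL]
    _ < ε := hu3
end
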